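/- Let n = 2ν be even, J₀ the canonical antisymmetric matrix of order n, and f : 𝔸ₙ → ℝ a Frechet differentiable function on the space of real antisymmetric n×n matrices. Define V(X) := f(X J₀ Xᵀ) for X ∈ ℝ^{n×n}. Then V satisfies the partial differential equation 𝐒(Xᵀ (∂_X V) J₀) = 0 at every X ∈ ℝ^{n×n}, where ∂_X V is the Frobenius gradient of V and 𝐒(N) := (N+Nᵀ)/2. -/

import Mathlib

open Matrix
open scoped Kronecker

attribute [local instance] Matrix.frobeniusNormedAddCommGroup Matrix.frobeniusNormedSpace

/-- Index type for matrices of even order `n = 2ν`. -/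
abbrev Idx (ν : ℕ) := Fin ν × Fin 2

/-- The canonical antisymmetric matrix `J₀ = I_ν ⊗ [[0,1],[-1,0]]` of order `n = 2ν`. -/
noncomputable def J0 (ν : ℕ) : Matrix (Idx ν) (Idx ν) ℝ :=
  (1 : Matrix (Fin ν) (Fin ν) ℝ) ⊗ₖ !![(0 : ℝ), 1; -1, 0]

lemma J0_transpose (ν : ℕ) : (J0 ν)ᵀ = -J0 ν := by
  ext ⟨i, a⟩ ⟨j, b⟩
  simp only [J0, Matrix.transpose_apply, Matrix.kroneckerMap_apply, Matrix.neg_apply,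
    Matrix.one_apply]
  by_cases h : i = j
  · subst h
    fin_cases a <;> fin_cases b <;> norm_num
  · simp [h, Ne.symm h]

/-- The subspace `𝔸ₙ` of real antisymmetric matrices. -/
def skewMat (ν : ℕ) : Submodule ℝ (Matrix (Idx ν) (Idx ν) ℝ) where
  carrier := {Y | Yᵀ = -Y}
  add_mem' := by
    intro a b ha hb
    simp only [Set.mem_setOf_eq] at *
    rw [Matrix.transpose_add, ha, hb, neg_add]
  zero_mem' := by simp
  smul_mem' := by
    intro c a ha
    simp only [Set.mem_setOf_eq] at *
    rw [Matrix.transpose_smul, ha, smul_neg]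

lemma mem_skewMat {ν : ℕ} {A : Matrix (Idx ν) (Idx ν) ℝ} : A ∈ skewMat ν ↔ Aᵀ = -A :=
  Iff.rfl

/-- The Frobenius inner product `⟨A, B⟩ = tr(Aᵀ B)`. -/
noncomputable def frob {ν : ℕ} (A B : Matrix (Idx ν) (Idx ν) ℝ) : ℝ :=
  (Aᵀ * B).trace

/-- The map `X ↦ X J₀ Xᵀ`, landing in antisymmetric matrices. -/
noncomputable def Omap (ν : ℕ) (X : Matrix (Idx ν) (Idx ν) ℝ) : skewMat ν :=
  ⟨X * J0 ν * Xᵀ, by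
    rw [mem_skewMat, Matrix.transpose_mul, Matrix.transpose_mul, Matrix.transpose_transpose,
      J0_transpose, Matrix.mul_assoc, Matrix.neg_mul, Matrix.mul_neg]⟩

lemma J0_mul_self (ν : ℕ) : J0 ν * J0 ν = -1 := by
  have h : !![(0 : ℝ), 1; -1, 0] * !![(0 : ℝ), 1; -1, 0] = (-1 : ℝ) • 1 := by
    ext a b
    fin_cases a <;> fin_cases b <;> simp [Matrix.mul_apply]
  rw [J0, ← Matrix.mul_kronecker_mul, h, Matrix.kronecker_smul, one_mul,
    Matrix.one_kronecker_one, neg_one_smul]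

/-- Along a Hamiltonian direction `X * (S * J₀)` with `S` symmetric, `X ↦ X J₀ Xᵀ` is constant
to first order. -/
lemma Omap_add_smul_hamiltonian {ν : ℕ} (X S : Matrix (Idx ν) (Idx ν) ℝ) (hS : Sᵀ = S) (t : ℝ) :
    Omap ν (X + t • (X * (S * J0 ν))) = Omap ν X + t ^ 2 • Omap ν (X * (S * J0 ν)) := by
  have h₁ : X * (S * J0 ν) * J0 ν * Xᵀ = -(X * S * Xᵀ) := by
    rw [← Matrix.mul_assoc X, Matrix.mul_assoc (X * S), J0_mul_self]
    simp
  have h₂ : X * J0 ν * (X * (S * J0 ν))ᵀ = X * S * Xᵀ := by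
    rw [Matrix.transpose_mul, Matrix.transpose_mul, hS, J0_transpose]
    calc X * J0 ν * (-J0 ν * S * Xᵀ) = -(X * (J0 ν * J0 ν) * S * Xᵀ) := by
          simp only [Matrix.neg_mul, Matrix.mul_neg, Matrix.mul_assoc]
      _ = X * S * Xᵀ := by simp [J0_mul_self]
  apply Subtype.ext
  change (X + t • (X * (S * J0 ν))) * J0 ν * (X + t • (X * (S * J0 ν)))ᵀ =
    X * J0 ν * Xᵀ + t ^ 2 • (X * (S * J0 ν) * J0 ν * (X * (S * J0 ν))ᵀ)
  rw [Matrix.transpose_add, Matrix.transpose_smul, Matrix.add_mul, Matrix.add_mul,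
    Matrix.mul_add, Matrix.mul_add]
  simp only [Matrix.smul_mul, Matrix.mul_smul, h₁, h₂, smul_smul, smul_neg, pow_two]
  abel

lemma hasDerivAt_add_sq_smul_zero {E : Type*} [NormedAddCommGroup E] [NormedSpace ℝ E]
    (a b : E) : HasDerivAt (fun t : ℝ => a + t ^ 2 • b) 0 0 := by
  simpa using ((hasDerivAt_pow 2 (0 : ℝ)).smul_const b).const_add a

/-- The derivative of `X ↦ f (X J₀ Xᵀ)` vanishes along Hamiltonian directions. -/
lemma fderiv_comp_Omap_hamiltonian {ν : ℕ} {f : skewMat ν → ℝ}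
    {X : Matrix (Idx ν) (Idx ν) ℝ} (hf : DifferentiableAt ℝ f (Omap ν X))
    {L : Matrix (Idx ν) (Idx ν) ℝ →L[ℝ] ℝ} (hd : HasFDerivAt (fun X => f (Omap ν X)) L X)
    {S : Matrix (Idx ν) (Idx ν) ℝ} (hS : Sᵀ = S) : L (X * (S * J0 ν)) = 0 := by
  have hline := hd.hasLineDerivAt (X * (S * J0 ν))
  unfold HasLineDerivAt at hline
  simp only [Omap_add_smul_hamiltonian X S hS] at hline
  have hcurve : HasDerivAt (fun t : ℝ => Omap ν X + t ^ 2 • Omap ν (X * (S * J0 ν))) 0 0 :=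
    hasDerivAt_add_sq_smul_zero _ _
  have hcomp := HasFDerivAt.comp_hasDerivAt_of_eq (0 : ℝ) hf.hasFDerivAt hcurve (by simp)
  exact (hline.unique hcomp).trans (ContinuousLinearMap.map_zero _)

/-- A real matrix that is Frobenius-orthogonal to its symmetrization is antisymmetric. -/
lemma add_transpose_eq_zero_of_trace {n : Type*} [Fintype n] {M : Matrix n n ℝ}
    (h : (Mᵀ * (M + Mᵀ)).trace = 0) : M + Mᵀ = 0 := by
  have h' : (M * (M + Mᵀ)).trace = 0 := by
    rw [← Matrix.trace_transpose, Matrix.transpose_mul, Matrix.trace_mul_comm,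
      Matrix.transpose_add, Matrix.transpose_transpose, add_comm Mᵀ M]
    exact h
  rw [← Matrix.trace_conjTranspose_mul_self_eq_zero_iff, Matrix.conjTranspose_eq_transpose_of_trivial,
    Matrix.transpose_add, Matrix.transpose_transpose, Matrix.add_mul, Matrix.trace_add, h, h',
    add_zero]

theorem stmt_11 (ν : ℕ)
    (f : skewMat ν → ℝ) (hf : Differentiable ℝ f)
    (X : Matrix (Idx ν) (Idx ν) ℝ)
    -- Frobenius gradient data ∂_X V of V(X) := f(X J₀ Xᵀ) at X
    (gX : Matrix (Idx ν) (Idx ν) ℝ)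
    (L : Matrix (Idx ν) (Idx ν) ℝ →L[ℝ] ℝ)
    (hd : HasFDerivAt (fun X => f (Omap ν X)) L X)
    (hrep : ∀ δ, L δ = frob gX δ) :
    -- the PDE 𝐒(Xᵀ (∂_X V) J₀) = 0
    (1 / 2 : ℝ) • (Xᵀ * gX * J0 ν + (Xᵀ * gX * J0 ν)ᵀ) = 0 := by
  have hS : (Xᵀ * gX * J0 ν + (Xᵀ * gX * J0 ν)ᵀ)ᵀ = Xᵀ * gX * J0 ν + (Xᵀ * gX * J0 ν)ᵀ := by
    rw [Matrix.transpose_add, Matrix.transpose_transpose, add_comm]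
  have hL := fderiv_comp_Omap_hamiltonian (hf _) hd hS
  rw [hrep, frob, ← Matrix.mul_assoc X, ← Matrix.mul_assoc, Matrix.trace_mul_comm] at hL
  rw [add_transpose_eq_zero_of_trace, smul_zero]
  rw [← neg_eq_zero, ← hL, ← Matrix.trace_neg]
  congr 1
  generalize Xᵀ * gX * J0 ν + (Xᵀ * gX * J0 ν)ᵀ = S
  simp only [Matrix.transpose_mul, Matrix.transpose_transpose, J0_transpose, Matrix.neg_mul,
    neg_neg, Matrix.mul_assoc]
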